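/- Let p : ℕ → ℝ be strictly positive and let q : ℕ → ℝ be nonnegative and not identically zero on the positive integers. Then the left-definite space H₁ is complete: for every sequence (u_k)_{k∈ℕ} of elements of H₁ that is Cauchy with respect to the distance d(u, v) = (∑_{n=1}^∞ (p(n)|(Δ(u−v))(n)|² + q(n)|u(n)−v(n)|²))^{1/2}, there exists u ∈ H₁ such that d(u_k, u) → 0 as k → ∞. -/

import Mathlib

/-- `u` belongs to the left-definite space `H₁`:
`∑_{n=1}^∞ (p(n)|(Δu)(n)|² + q(n)|u(n)|²) < ∞`. -/
def memH1 (p q : ℕ → ℝ) (u : ℕ → ℂ) : Prop :=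
  Summable (fun n : ℕ =>
    p (n + 1) * ‖u (n + 2) - u (n + 1)‖ ^ 2 + q (n + 1) * ‖u (n + 1)‖ ^ 2)

/-- The `H₁`-distance `d(u,v) = (∑_{n=1}^∞ (p(n)|(Δ(u−v))(n)|² + q(n)|u(n)−v(n)|²))^{1/2}`. -/
noncomputable def distH1 (p q : ℕ → ℝ) (u v : ℕ → ℂ) : ℝ :=
  Real.sqrt (∑' n : ℕ,
    (p (n + 1) * ‖(u (n + 2) - v (n + 2)) - (u (n + 1) - v (n + 1))‖ ^ 2
      + q (n + 1) * ‖u (n + 1) - v (n + 1)‖ ^ 2))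

/-- The `n`-th term of the series defining the squared `H₁`-norm of `u`. -/
noncomputable def energyH1 (p q : ℕ → ℝ) (u : ℕ → ℂ) (n : ℕ) : ℝ :=
  p (n + 1) * ‖u (n + 2) - u (n + 1)‖ ^ 2 + q (n + 1) * ‖u (n + 1)‖ ^ 2

section H1

variable {p q : ℕ → ℝ}

lemma energyH1_nonneg (hp : ∀ n, 0 < p n) (hq : ∀ n, 0 ≤ q n) (u : ℕ → ℂ) (n : ℕ) :
    0 ≤ energyH1 p q u n :=
  add_nonneg (mul_nonneg (hp _).le (sq_nonneg _)) (mul_nonneg (hq _) (sq_nonneg _))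

lemma norm_sub_sq_le_two_mul (a b : ℂ) : ‖a - b‖ ^ 2 ≤ 2 * ‖a‖ ^ 2 + 2 * ‖b‖ ^ 2 := by
  have h := parallelogram_law_with_norm ℝ a b
  nlinarith [mul_self_nonneg ‖a + b‖]

lemma energyH1_sub_le (hp : ∀ n, 0 < p n) (hq : ∀ n, 0 ≤ q n) (u v : ℕ → ℂ) (n : ℕ) :
    energyH1 p q (u - v) n ≤ 2 * energyH1 p q u n + 2 * energyH1 p q v n := by
  have h₁ := mul_le_mul_of_nonneg_left
    (norm_sub_sq_le_two_mul (u (n + 2) - u (n + 1)) (v (n + 2) - v (n + 1))) (hp (n + 1)).le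
  have h₂ := mul_le_mul_of_nonneg_left
    (norm_sub_sq_le_two_mul (u (n + 1)) (v (n + 1))) (hq (n + 1))
  simp only [energyH1, Pi.sub_apply]
  rw [sub_sub_sub_comm]
  linarith

lemma memH1.sub (hp : ∀ n, 0 < p n) (hq : ∀ n, 0 ≤ q n) {u v : ℕ → ℂ}
    (hu : memH1 p q u) (hv : memH1 p q v) : memH1 p q (u - v) :=
  Summable.of_nonneg_of_le (energyH1_nonneg hp hq _) (energyH1_sub_le hp hq u v)
    ((Summable.mul_left 2 hu).add (Summable.mul_left 2 hv))

lemma sum_energyH1_sub_le_distH1_sq (hp : ∀ n, 0 < p n) (hq : ∀ n, 0 ≤ q n) {u v : ℕ → ℂ}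
    (hu : memH1 p q u) (hv : memH1 p q v) (s : Finset ℕ) :
    ∑ n ∈ s, energyH1 p q (u - v) n ≤ distH1 p q u v ^ 2 := by
  have h : distH1 p q u v ^ 2 = ∑' n, energyH1 p q (u - v) n :=
    Real.sq_sqrt (tsum_nonneg (energyH1_nonneg hp hq (u - v)))
  rw [h]
  exact Summable.sum_le_tsum s (fun n _ => energyH1_nonneg hp hq _ n) (hu.sub hp hq hv)

/-- If a positive multiple of `‖f j - f k‖ ^ 2` is dominated by the square of a quantity that
satisfies the Cauchy criterion, then `f` is a Cauchy sequence. -/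
lemma cauchySeq_of_mul_norm_sub_sq_le {f : ℕ → ℂ} {d : ℕ → ℕ → ℝ} {c : ℝ} (hc : 0 < c)
    (hd : ∀ j k, 0 ≤ d j k) (hfd : ∀ j k, c * ‖f j - f k‖ ^ 2 ≤ d j k ^ 2)
    (hcauchy : ∀ ε : ℝ, 0 < ε → ∃ K : ℕ, ∀ j, K ≤ j → ∀ k, K ≤ k → d j k < ε) :
    CauchySeq f := by
  refine Metric.cauchySeq_iff.2 fun ε hε => ?_
  obtain ⟨K, hK⟩ := hcauchy (√c * ε) (by positivity)
  refine ⟨K, fun j hj k hk => ?_⟩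
  have h : √c * ‖f j - f k‖ ≤ d j k := by
    refine (sq_le_sq₀ (by positivity) (hd j k)).1 ?_
    rw [mul_pow, Real.sq_sqrt hc.le]
    exact hfd j k
  rw [dist_eq_norm]
  exact lt_of_mul_lt_mul_left (h.trans_lt (hK j hj k hk)) (Real.sqrt_nonneg c)

/-- A Cauchy sequence in `H₁` is pointwise Cauchy on the positive integers. -/
lemma cauchySeq_apply_of_cauchy_distH1 (hp : ∀ n, 0 < p n) (hq : ∀ n, 0 ≤ q n)
    (hq0 : ∃ k, 1 ≤ k ∧ 0 < q k) {u : ℕ → ℕ → ℂ} (hmem : ∀ k, memH1 p q (u k))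
    (hcauchy : ∀ ε : ℝ, 0 < ε → ∃ K : ℕ, ∀ j, K ≤ j → ∀ k, K ≤ k →
      distH1 p q (u j) (u k) < ε) (n : ℕ) :
    CauchySeq fun k => u k (n + 1) := by
  have hterm (j k n : ℕ) : energyH1 p q (u j - u k) n ≤ distH1 p q (u j) (u k) ^ 2 := by
    simpa using sum_energyH1_sub_le_distH1_sq hp hq (hmem j) (hmem k) {n}
  have hnonneg (j k : ℕ) : 0 ≤ distH1 p q (u j) (u k) := Real.sqrt_nonneg _
  have hdiff (n : ℕ) : CauchySeq fun k => u k (n + 2) - u k (n + 1) := by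
    refine cauchySeq_of_mul_norm_sub_sq_le (hp (n + 1)) hnonneg (fun j k => ?_) hcauchy
    rw [sub_sub_sub_comm]
    exact (le_add_of_nonneg_right (mul_nonneg (hq _) (sq_nonneg _))).trans (hterm j k n)
  have hstep (n : ℕ) :
      (CauchySeq fun k => u k (n + 1)) ↔ CauchySeq fun k => u k (n + 1 + 1) := by
    refine ⟨fun h => ?_, fun h => ?_⟩
    · simpa [Pi.add_def] using h.add (hdiff n)
    · simpa [Pi.add_def, sub_eq_add_neg] using h.add (hdiff n).neg
  have hzero (n : ℕ) : (CauchySeq fun k => u k (n + 1)) ↔ CauchySeq fun k => u k (0 + 1) := by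
    induction n with
    | zero => rfl
    | succ n ih => exact (hstep n).symm.trans ih
  obtain ⟨m, hm, hqm⟩ := hq0
  obtain ⟨m, rfl⟩ := Nat.exists_eq_add_of_le' hm
  refine (hzero n).2 ((hzero m).1 ?_)
  exact cauchySeq_of_mul_norm_sub_sq_le hqm hnonneg (fun j k =>
    (le_add_of_nonneg_left (mul_nonneg (hp _).le (sq_nonneg _))).trans (hterm j k m)) hcauchy

lemma tendsto_energyH1_sub {u : ℕ → ℕ → ℂ} {v : ℕ → ℂ}
    (h : ∀ n, Filter.Tendsto (fun k => u k (n + 1)) Filter.atTop (nhds (v (n + 1))))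
    (w : ℕ → ℂ) (n : ℕ) :
    Filter.Tendsto (fun k => energyH1 p q (w - u k) n) Filter.atTop
      (nhds (energyH1 p q (w - v) n)) := by
  have h₁ := (h n).const_sub (w (n + 1))
  have h₂ := (h (n + 1)).const_sub (w (n + 2))
  exact (((h₂.sub h₁).norm.pow 2).const_mul _).add ((h₁.norm.pow 2).const_mul _)

end H1

/-- The left-definite space `H₁` is complete: every Cauchy sequence in `H₁` converges
to an element of `H₁` with respect to the `H₁`-distance. -/
theorem H1_complete (p : ℕ → ℝ) (hp : ∀ l, 0 < p l)
    (q : ℕ → ℝ) (hq : ∀ n, 0 ≤ q n) (hq0 : ∃ k, 1 ≤ k ∧ 0 < q k)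
    (u : ℕ → ℕ → ℂ)
    (hmem : ∀ k, memH1 p q (u k))
    (hcauchy : ∀ ε : ℝ, 0 < ε → ∃ K : ℕ, ∀ j, K ≤ j → ∀ k, K ≤ k →
      distH1 p q (u j) (u k) < ε) :
    ∃ ulim : ℕ → ℂ, memH1 p q ulim ∧
      Filter.Tendsto (fun k : ℕ => distH1 p q (u k) ulim) Filter.atTop (nhds 0) := by
  have hlim (n : ℕ) := cauchySeq_tendsto_of_complete
    (cauchySeq_apply_of_cauchy_distH1 hp hq hq0 hmem hcauchy n)
  choose v hv using hlim
  let ulim : ℕ → ℂ := fun n => v (n - 1)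
  have hbound (ε : ℝ) (hε : 0 < ε) : ∃ K : ℕ, ∀ j, K ≤ j → ∀ s : Finset ℕ,
      ∑ n ∈ s, energyH1 p q (u j - ulim) n ≤ ε ^ 2 := by
    obtain ⟨K, hK⟩ := hcauchy ε hε
    refine ⟨K, fun j hj s => ?_⟩
    refine le_of_tendsto (tendsto_finsetSum s fun n _ =>
      tendsto_energyH1_sub (p := p) (q := q) (v := ulim) hv (u j) n) ?_
    filter_upwards [Filter.eventually_ge_atTop K] with k hk
    exact (sum_energyH1_sub_le_distH1_sq hp hq (hmem j) (hmem k) s).trans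
      (pow_le_pow_left₀ (Real.sqrt_nonneg _) (hK j hj k hk).le 2)
  refine ⟨ulim, ?_, ?_⟩
  · obtain ⟨K, hK⟩ := hbound 1 one_pos
    have hsub : memH1 p q (u K - ulim) :=
      summable_of_sum_le (energyH1_nonneg hp hq _) (hK K le_rfl)
    simpa using (hmem K).sub hp hq hsub
  · refine Metric.tendsto_atTop.2 fun ε hε => ?_
    obtain ⟨K, hK⟩ := hbound (ε / 2) (half_pos hε)
    refine ⟨K, fun j hj => ?_⟩
    have hle : distH1 p q (u j) ulim ≤ ε / 2 := by
      refine Real.sqrt_le_iff.2 ⟨(half_pos hε).le, ?_⟩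
      exact Real.tsum_le_of_sum_le (energyH1_nonneg hp hq (u j - ulim)) (hK j hj)
    have hnonneg : 0 ≤ distH1 p q (u j) ulim := Real.sqrt_nonneg _
    rw [Real.dist_eq, sub_zero, abs_of_nonneg hnonneg]
    exact hle.trans_lt (half_lt_self hε)
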